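/- On ℍ, with the Hwang–Singer data ρ, ξ₁, ξ₂, x₁, x₂, the following four identities hold at every point: ∂x₁/∂H = r·∂ξ₂/∂r, ∂x₁/∂r = −r·∂ξ₂/∂H, ∂x₂/∂H = −r·∂ξ₁/∂r, and ∂x₂/∂r = r·∂ξ₁/∂H. That is, x₁ and x₂ are primitives of the 1-forms ε₁ = r(∂ξ₂/∂r·dH − ∂ξ₂/∂H·dr) and ε₂ = −r(∂ξ₁/∂r·dH − ∂ξ₁/∂H·dr). -/

import Mathlib

theorem hasDerivAt_half_log_sub {u s : ℝ → ℝ} {u' s' t : ℝ} (hu : HasDerivAt u u' t)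
    (hs : HasDerivAt s s' t) (hu0 : u t ≠ 0) (hs0 : s t ≠ 0) :
    HasDerivAt (fun t => (1/2) * Real.log (u t) - 1 / (2 * s t))
      (u' / (2 * u t) + s' / (2 * s t ^ 2)) t := by
  refine HasDerivAt.congr_deriv (((hu.log hu0).const_mul (1/2)).sub
    ((hasDerivAt_const t (1 : ℝ)).div (hs.const_mul 2) (mul_ne_zero two_ne_zero hs0))) ?_
  field_simp
  ring

theorem hasDerivAt_half_add_div {u s h : ℝ → ℝ} {u' s' h' t : ℝ} (hu : HasDerivAt u u' t)
    (hs : HasDerivAt s s' t) (hh : HasDerivAt h h' t) (hs0 : s t ≠ 0) :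
    HasDerivAt (fun t => u t / 2 + h t / (2 * s t))
      (u' / 2 + (h' * s t - h t * s') / (2 * s t ^ 2)) t := by
  refine HasDerivAt.congr_deriv ((hu.div_const 2).add (hh.div (hs.const_mul 2) (mul_ne_zero two_ne_zero hs0))) ?_
  field_simp

theorem hasDerivAt_half_sub_div {u s h : ℝ → ℝ} {u' s' h' t : ℝ} (hu : HasDerivAt u u' t)
    (hs : HasDerivAt s s' t) (hh : HasDerivAt h h' t) (hs0 : s t ≠ 0) :
    HasDerivAt (fun t => u t / 2 - h t / (2 * s t))
      (u' / 2 - (h' * s t - h t * s') / (2 * s t ^ 2)) t := by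
  refine HasDerivAt.congr_deriv ((hu.div_const 2).sub (hh.div (hs.const_mul 2) (mul_ne_zero two_ne_zero hs0))) ?_
  field_simp

theorem hasDerivAt_sqrt_sq_add_sq_left {H r : ℝ} (h : H ^ 2 + r ^ 2 ≠ 0) :
    HasDerivAt (fun H' => Real.sqrt (H' ^ 2 + r ^ 2)) (H / Real.sqrt (H ^ 2 + r ^ 2)) H := by
  refine HasDerivAt.congr_deriv (((hasDerivAt_pow 2 H).add_const (r ^ 2)).sqrt h) ?_
  field_simp
  norm_num

theorem hasDerivAt_sqrt_sq_add_sq_right {H r : ℝ} (h : H ^ 2 + r ^ 2 ≠ 0) :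
    HasDerivAt (fun r' => Real.sqrt (H ^ 2 + r' ^ 2)) (r / Real.sqrt (H ^ 2 + r ^ 2)) r := by
  simpa only [add_comm (H ^ 2)] using
    hasDerivAt_sqrt_sq_add_sq_left (H := r) (r := H) (by rwa [add_comm])


/-- On `ℍ = {(H,r) : r > 0}`, with the Hwang–Singer data
`ρ = √(H²+r²)`, `ξ₁ = (1/2)log(H+ρ) − 1/(2ρ)`, `ξ₂ = (1/2)log(ρ−H) − 1/(2ρ)`,
`x₁ = (H+ρ)/2 + H/(2ρ)`, `x₂ = (ρ−H)/2 − H/(2ρ)`, one has at every point: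
`∂x₁/∂H = r·∂ξ₂/∂r`, `∂x₁/∂r = −r·∂ξ₂/∂H`, `∂x₂/∂H = −r·∂ξ₁/∂r`,
`∂x₂/∂r = r·∂ξ₁/∂H`. -/
theorem stmt_12 (ξ₁ ξ₂ x₁ x₂ : ℝ → ℝ → ℝ)
    (hξ₁ : ∀ H r : ℝ, ξ₁ H r =
      (1/2) * Real.log (H + Real.sqrt (H^2 + r^2))
        - 1 / (2 * Real.sqrt (H^2 + r^2)))
    (hξ₂ : ∀ H r : ℝ, ξ₂ H r =
      (1/2) * Real.log (Real.sqrt (H^2 + r^2) - H)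
        - 1 / (2 * Real.sqrt (H^2 + r^2)))
    (hx₁ : ∀ H r : ℝ, x₁ H r =
      (H + Real.sqrt (H^2 + r^2)) / 2 + H / (2 * Real.sqrt (H^2 + r^2)))
    (hx₂ : ∀ H r : ℝ, x₂ H r =
      (Real.sqrt (H^2 + r^2) - H) / 2 - H / (2 * Real.sqrt (H^2 + r^2))) :
    ∀ H r : ℝ, 0 < r →
      deriv (fun H' => x₁ H' r) H = r * deriv (fun r' => ξ₂ H r') r ∧
      deriv (fun r' => x₁ H r') r = -(r * deriv (fun H' => ξ₂ H' r) H) ∧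
      deriv (fun H' => x₂ H' r) H = -(r * deriv (fun r' => ξ₁ H r') r) ∧
      deriv (fun r' => x₂ H r') r = r * deriv (fun H' => ξ₁ H' r) H := by
  intro H r hr
  have h0 : H ^ 2 + r ^ 2 ≠ 0 := by positivity
  have hH := hasDerivAt_sqrt_sq_add_sq_left h0
  have hR := hasDerivAt_sqrt_sq_add_sq_right h0
  have hρ : 0 < Real.sqrt (H ^ 2 + r ^ 2) := by positivity
  have hsq : Real.sqrt (H ^ 2 + r ^ 2) ^ 2 = H ^ 2 + r ^ 2 := Real.sq_sqrt (by positivity)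
  have habs : |H| < Real.sqrt (H ^ 2 + r ^ 2) :=
    abs_lt_of_sq_lt_sq (by rw [hsq]; exact lt_add_of_pos_right _ (by positivity)) hρ.le
  have hadd : H + Real.sqrt (H ^ 2 + r ^ 2) ≠ 0 :=
    (neg_lt_iff_pos_add.mp (abs_lt.mp habs).1).ne'
  have hsub : Real.sqrt (H ^ 2 + r ^ 2) - H ≠ 0 := (sub_pos.mpr (abs_lt.mp habs).2).ne'
  have hid := hasDerivAt_id' H
  have hc := hasDerivAt_const r H
  simp only [hξ₁, hξ₂, hx₁, hx₂]
  rw [(hasDerivAt_half_add_div (hid.fun_add hH) hH hid hρ.ne').deriv,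
    (hasDerivAt_half_add_div (hc.fun_add hR) hR hc hρ.ne').deriv,
    (hasDerivAt_half_sub_div (hH.fun_sub hid) hH hid hρ.ne').deriv,
    (hasDerivAt_half_sub_div (hR.fun_sub hc) hR hc hρ.ne').deriv,
    (hasDerivAt_half_log_sub (hid.fun_add hH) hH hadd hρ.ne').deriv,
    (hasDerivAt_half_log_sub (hc.fun_add hR) hR hadd hρ.ne').deriv,
    (hasDerivAt_half_log_sub (hH.fun_sub hid) hH hsub hρ.ne').deriv,
    (hasDerivAt_half_log_sub (hR.fun_sub hc) hR hsub hρ.ne').deriv]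
  generalize Real.sqrt (H ^ 2 + r ^ 2) = ρ at *
  have hr2 : r ^ 2 = ρ ^ 2 - H ^ 2 := by linarith
  have hρ0 := hρ.ne'
  refine ⟨?_, ?_, ?_, ?_⟩ <;> field_simp <;> grind
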